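/- arXiv:2506.16666 — 3 statements merged into one kernel-verified Lean document; each statement's English description precedes it below -/
import Mathlib

section
/- Let μ > 0, let P be the Gaussian measure N(0,1) on ℝ and Q the Gaussian measure N(μ,1) on ℝ, and let Φ denote the cumulative distribution function of the standard Gaussian N(0,1). Then for every measurable set S ⊆ ℝ and every real t, if P(S) ≤ 1 − Φ(t), then 1 − Q(S) ≥ Φ(t − μ). In particular, the one-sided threshold test with rejection region (t, ∞) minimizes the type II error among all tests of the same type I error level. -/
open MeasureTheory ProbabilityTheory

/-- **Neyman-Pearson lemma**: if the likelihood ratio of `Q` against `P` is at least `c` on `T` and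
at most `c` off `T`, then `T` maximizes the power among rejection regions of no larger size. -/
lemma measureReal_le_of_likelihoodRatio {Ω : Type*} [MeasurableSpace Ω] {P Q : Measure Ω}
    [IsFiniteMeasure P] [IsFiniteMeasure Q] {S T : Set Ω} {c : ℝ} (hc : 0 ≤ c)
    (hS : MeasurableSet S) (hT : MeasurableSet T)
    (hle : ∀ A, MeasurableSet A → A ⊆ Tᶜ → Q.real A ≤ c * P.real A)
    (hge : ∀ A, MeasurableSet A → A ⊆ T → c * P.real A ≤ Q.real A)
    (hPS : P.real S ≤ P.real T) : Q.real S ≤ Q.real T := by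
  have h₁ := hle (S \ T) (hS.diff hT) fun _ hx ↦ hx.2
  have h₂ := hge (T \ S) (hT.diff hS) Set.sdiff_subset
  have hP₁ := measureReal_inter_add_sdiff (μ := P) (s := S) hT
  have hP₂ := measureReal_inter_add_sdiff (μ := P) (s := T) hS
  have hQ₁ := measureReal_inter_add_sdiff (μ := Q) (s := S) hT
  have hQ₂ := measureReal_inter_add_sdiff (μ := Q) (s := T) hS
  rw [Set.inter_comm] at hP₂ hQ₂
  have : c * P.real (S \ T) ≤ c * P.real (T \ S) :=
    mul_le_mul_of_nonneg_left (by linarith) hc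
  linarith

lemma gaussianPDFReal_eq_exp_mul (μ x : ℝ) :
    gaussianPDFReal μ 1 x = Real.exp (μ * x - μ ^ 2 / 2) * gaussianPDFReal 0 1 x := by
  simp only [gaussianPDFReal, NNReal.coe_one, mul_one, sub_zero]
  rw [mul_left_comm, ← Real.exp_add]
  ring_nf

lemma measureReal_gaussianReal (μ : ℝ) (A : Set ℝ) :
    (gaussianReal μ 1).real A = ∫ x in A, gaussianPDFReal μ 1 x := by
  rw [measureReal_def, gaussianReal_apply_eq_integral μ one_ne_zero,
    ENNReal.toReal_ofReal (integral_nonneg fun x ↦ gaussianPDFReal_nonneg μ 1 x)]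

lemma measureReal_Ioi_eq_one_sub_cdf (P : Measure ℝ) [IsProbabilityMeasure P] (t : ℝ) :
    P.real (Set.Ioi t) = 1 - cdf P t := by
  rw [cdf_eq_real, ← Set.compl_Iic, probReal_compl_eq_one_sub measurableSet_Iic]

lemma cdf_gaussianReal_eq_cdf_sub (μ t : ℝ) :
    cdf (gaussianReal μ 1) t = cdf (gaussianReal 0 1) (t - μ) := by
  have h := gaussianReal_map_add_const (μ := 0) (v := 1) μ
  rw [zero_add] at h
  rw [cdf_eq_real, cdf_eq_real, ← h, map_measureReal_apply (by fun_prop) measurableSet_Iic]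
  congr 1
  ext x
  simp [le_sub_iff_add_le]

/-- Optimality of the one-sided Gaussian threshold test (Neyman-Pearson for
`N(0,1)` vs `N(μ,1)`): for any measurable rejection region `S` and threshold `t`,
if the type I error `P(S)` is at most `1 - Φ(t)`, then the type II error
`1 - Q(S)` is at least `Φ(t - μ)`. -/
theorem gaussian_tradeoff {μ : ℝ} (hμ : 0 < μ) :
    ∀ S : Set ℝ, MeasurableSet S → ∀ t : ℝ,
      ((gaussianReal 0 1) S).toReal ≤ 1 - cdf (gaussianReal 0 1) t →
      1 - ((gaussianReal μ 1) S).toReal ≥ cdf (gaussianReal 0 1) (t - μ) := by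
  intro S hS t h
  rw [← measureReal_Ioi_eq_one_sub_cdf] at h
  have key : (gaussianReal μ 1).real S ≤ (gaussianReal μ 1).real (Set.Ioi t) := by
    refine measureReal_le_of_likelihoodRatio (P := gaussianReal 0 1)
      (Real.exp_nonneg (μ * t - μ ^ 2 / 2)) hS measurableSet_Ioi ?_ ?_ h
    all_goals
      intro A hA hAT
      rw [measureReal_gaussianReal, measureReal_gaussianReal, ← integral_const_mul]
      refine setIntegral_mono_on ?_ ?_ hA fun x hx ↦ ?_
      any_goals exact (integrable_gaussianPDFReal _ _).integrableOn
      any_goals exact ((integrable_gaussianPDFReal _ _).const_mul _).integrableOn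
      rw [gaussianPDFReal_eq_exp_mul μ x]
      refine mul_le_mul_of_nonneg_right (Real.exp_le_exp.2 ?_) (gaussianPDFReal_nonneg 0 1 x)
      have hxT := hAT hx
      simp only [Set.mem_compl_iff, Set.mem_Ioi, not_lt] at hxT
      nlinarith
  rw [measureReal_Ioi_eq_one_sub_cdf, cdf_gaussianReal_eq_cdf_sub, measureReal_def] at key
  linarith
end

section
/- Let P and Q be probability measures on a measurable space Ω, let ε ≥ 0 and δ ∈ [0,1], and suppose that for every measurable set S ⊆ Ω, P(S) ≤ exp(ε)·Q(S) + δ and Q(S) ≤ exp(ε)·P(S) + δ. Then for every measurable set S ⊆ Ω, the type II error satisfies 1 − Q(S) ≥ max{0, 1 − δ − exp(ε)·P(S), exp(−ε)·(1 − δ − P(S))}. -/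
open MeasureTheory

/-- `(ε,δ)`-DP implies the trade-off lower bound
`f_{ε,δ}(α) = max {0, 1 - δ - exp ε * α, exp (-ε) * (1 - δ - α)}` on the
type II error `1 - Q(S)`, where `α = P(S)` is the type I error. -/
theorem dp_tradeoff_lower_bound {Ω : Type*} [MeasurableSpace Ω]
    (P Q : Measure Ω) [IsProbabilityMeasure P] [IsProbabilityMeasure Q]
    (ε δ : ℝ) (hε : 0 ≤ ε) (hδ0 : 0 ≤ δ) (hδ1 : δ ≤ 1)
    (hDP : ∀ S : Set Ω, MeasurableSet S →
        (P S).toReal ≤ Real.exp ε * (Q S).toReal + δ ∧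
        (Q S).toReal ≤ Real.exp ε * (P S).toReal + δ) :
    ∀ S : Set Ω, MeasurableSet S →
      1 - (Q S).toReal ≥
        max 0 (max (1 - δ - Real.exp ε * (P S).toReal)
          (Real.exp (-ε) * (1 - δ - (P S).toReal))) := by
  intro S hS
  have hP : (P Sᶜ).toReal = 1 - (P S).toReal := probReal_compl_eq_one_sub hS
  have hQ : (Q Sᶜ).toReal = 1 - (Q S).toReal := probReal_compl_eq_one_sub hS
  have hcompl := (hDP Sᶜ hS.compl).1
  rw [hP, hQ] at hcompl
  refine max_le ?_ (max_le ?_ ?_)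
  · rw [← hQ]
    exact ENNReal.toReal_nonneg
  · linarith [(hDP S hS).2]
  · rw [Real.exp_neg, inv_mul_le_iff₀ (Real.exp_pos ε)]
    linarith
end

section
/- Let P and Q be probability measures on a measurable space Ω, let ε ≥ 0, δ ≥ 0, and q ∈ [0,1], and suppose that for every measurable set S ⊆ Ω, P(S) ≤ exp(ε)·Q(S) + δ. Define the mixture R = (1 − q)·Q + q·P. Then for every measurable set S ⊆ Ω, R(S) ≤ (1 + q·(exp(ε) − 1))·Q(S) + q·δ; equivalently, R(S) ≤ exp(ε')·Q(S) + q·δ with ε' = log(1 + q·(exp(ε) − 1)). -/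
open MeasureTheory

/-- Privacy amplification by sub-sampling (mixture inequality): if `P` is
`(ε,δ)`-dominated by `Q` and `R = (1 - q) • Q + q • P`, then `R` is
`(ε', q·δ)`-dominated by `Q` with `exp ε' = 1 + q * (exp ε - 1)`,
i.e. `ε' = log (1 + q * (exp ε - 1))`. -/
theorem dp_subsampling_amplification {Ω : Type*} [MeasurableSpace Ω]
    (P Q : Measure Ω) [IsProbabilityMeasure P] [IsProbabilityMeasure Q]
    (ε δ q : ℝ) (hε : 0 ≤ ε) (hδ : 0 ≤ δ) (hq0 : 0 ≤ q) (hq1 : q ≤ 1)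
    (hDP : ∀ S : Set Ω, MeasurableSet S →
        (P S).toReal ≤ Real.exp ε * (Q S).toReal + δ)
    (R : Measure Ω)
    (hR : R = ENNReal.ofReal (1 - q) • Q + ENNReal.ofReal q • P) :
    ∀ S : Set Ω, MeasurableSet S →
      (R S).toReal ≤ (1 + q * (Real.exp ε - 1)) * (Q S).toReal + q * δ ∧
      (R S).toReal ≤
        Real.exp (Real.log (1 + q * (Real.exp ε - 1))) * (Q S).toReal + q * δ := by
  intro S hS
  have hpos : 0 < 1 + q * (Real.exp ε - 1) := by
    have h := mul_nonneg hq0 (sub_nonneg.mpr (Real.one_le_exp hε))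
    linarith
  have hmix : (R S).toReal = (1 - q) * (Q S).toReal + q * (P S).toReal := by
    rw [hR, Measure.add_apply, Measure.smul_apply, Measure.smul_apply, smul_eq_mul, smul_eq_mul,
      ENNReal.toReal_add (ENNReal.mul_ne_top ENNReal.ofReal_ne_top (measure_ne_top Q S))
        (ENNReal.mul_ne_top ENNReal.ofReal_ne_top (measure_ne_top P S)),
      ENNReal.toReal_mul, ENNReal.toReal_mul, ENNReal.toReal_ofReal (sub_nonneg.mpr hq1),
      ENNReal.toReal_ofReal hq0]
  rw [Real.exp_log hpos, and_self, hmix]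
  linarith [mul_le_mul_of_nonneg_left (hDP S hS) hq0]
end
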